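/- arXiv:2101.09549 — 9 statements merged into one kernel-verified Lean document; each statement's English description precedes it below -/
import Mathlib

section
/- Let G be a group with identity e, R a G-graded commutative ring with identity, M a graded R-module, I a graded ideal of R, N a graded submodule of M, and g ∈ G. If N_g = N ∩ M_g is a g-I_e-prime submodule of the R_e-module M_g, then either N_g is a g-prime submodule of M_g or (N_g :_{R_e} M_g) N_g ⊆ I_e N_g. -/
/- Common setup: a multiplicative group `G` with identity `1` (the paper's `e`),
a `G`-graded commutative ring `R` with grading `𝒜`, and a graded `R`-module `M`
with grading `ℳ`. -/

namespace GIePrime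

variable {G : Type*} [Group G] {R : Type*} [CommRing R]
  {M : Type*} [AddCommGroup M] [Module R M]

/-- The set of homogeneous elements determined by a family of additive subgroups. -/
def homog {α : Type*} [AddCommGroup α] (𝒜 : G → AddSubgroup α) : Set α :=
  ⋃ g, (𝒜 g : Set α)

/-- `R` is a `G`-graded ring via the family `𝒜`: `R = ⊕_g R_g`, `1 ∈ R_e` and
`R_g R_h ⊆ R_{gh}`. -/
def IsGradedRing [DecidableEq G] (𝒜 : G → AddSubgroup R) : Prop :=
  DirectSum.IsInternal 𝒜 ∧ (1 : R) ∈ 𝒜 1 ∧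
    ∀ ⦃g h : G⦄ ⦃a b : R⦄, a ∈ 𝒜 g → b ∈ 𝒜 h → a * b ∈ 𝒜 (g * h)

/-- `M` is a graded module over the `G`-graded ring `(R, 𝒜)` via the family `ℳ`:
`M = ⊕_g M_g` and `R_g M_h ⊆ M_{gh}`. -/
def IsGradedModule [DecidableEq G] (𝒜 : G → AddSubgroup R) (ℳ : G → AddSubgroup M) : Prop :=
  DirectSum.IsInternal ℳ ∧
    ∀ ⦃g h : G⦄ ⦃r : R⦄ ⦃m : M⦄, r ∈ 𝒜 g → m ∈ ℳ h → r • m ∈ ℳ (g * h)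

/-- An ideal `I` of `R` is graded when `I = ⊕_g (I ∩ R_g)`. -/
def IsGradedIdeal (𝒜 : G → AddSubgroup R) (I : Ideal R) : Prop :=
  (⨆ g : G, I.toAddSubgroup ⊓ 𝒜 g) = I.toAddSubgroup

/-- A submodule `N` of `M` is graded when `N = ⊕_g (N ∩ M_g)`. -/
def IsGradedSubmodule (ℳ : G → AddSubgroup M) (N : Submodule R M) : Prop :=
  (⨆ g : G, N.toAddSubgroup ⊓ ℳ g) = N.toAddSubgroup

/-- The `e`-component `I_e = I ∩ R_e` of a graded ideal (as a subset of `R`). -/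
def compE (𝒜 : G → AddSubgroup R) (I : Ideal R) : Set R :=
  (I : Set R) ∩ (𝒜 1 : Set R)

/-- The `g`-component `N_g = N ∩ M_g` of a graded submodule (as a subset of `M`). -/
def compG (ℳ : G → AddSubgroup M) (N : Submodule R M) (g : G) : Set M :=
  (N : Set M) ∩ (ℳ g : Set M)

/-- The submodule `I_e N` of `M`, generated by the products `a • n` with
`a ∈ I_e` and `n ∈ N`. -/
def ieSmul (𝒜 : G → AddSubgroup R) (I : Ideal R) (N : Submodule R M) : Submodule R M :=
  Ideal.span (compE 𝒜 I) • N

/-- `N` is an "`E`-prime" submodule relative to the sets `hR` (homogeneous elements of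
the ring), `hM` (homogeneous elements of the module) and the submodule `E` (playing the
role of `I_e N`): `N` is proper and whenever `r ∈ hR`, `m ∈ hM` with
`r • m ∈ N - E`, either `r ∈ (N :_R M)` or `m ∈ N`.  With `hR = h(R)`, `hM = h(M)` and
`E = I_e N` this is precisely the notion of a graded `I_e`-prime submodule. -/
def IsIePrimeSub {R' : Type*} [CommRing R'] {M' : Type*} [AddCommGroup M'] [Module R' M']
    (hR : Set R') (hM : Set M') (E : Submodule R' M') (N : Submodule R' M') : Prop :=
  N ≠ ⊤ ∧ ∀ r ∈ hR, ∀ m ∈ hM, r • m ∈ N → r • m ∉ E →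
    (∀ x : M', r • x ∈ N) ∨ m ∈ N

/-- `N` is a graded `I_e`-prime submodule of `M`. -/
def IsGradedIePrime (𝒜 : G → AddSubgroup R) (ℳ : G → AddSubgroup M)
    (I : Ideal R) (N : Submodule R M) : Prop :=
  IsIePrimeSub (homog 𝒜) (homog ℳ) (ieSmul 𝒜 I N) N

/-- `N` is a graded prime submodule of `M`. -/
def IsGradedPrime (𝒜 : G → AddSubgroup R) (ℳ : G → AddSubgroup M)
    (N : Submodule R M) : Prop :=
  N ≠ ⊤ ∧ ∀ r ∈ homog 𝒜, ∀ m ∈ homog ℳ, r • m ∈ N →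
    (∀ x : M, r • x ∈ N) ∨ m ∈ N

/-- The set of products `a • b` with `a ∈ A ⊆ R`, `b ∈ B ⊆ M`. -/
def smulSet (A : Set R) (B : Set M) : Set M := {x | ∃ a ∈ A, ∃ b ∈ B, x = a • b}

/-- The set of products `a * b` with `a ∈ A`, `b ∈ B`, subsets of `R`. -/
def mulSet (A B : Set R) : Set R := {x | ∃ a ∈ A, ∃ b ∈ B, x = a * b}

/-- The product `A B ⊆ M` of a set of ring elements and a set of module elements:
the additive subgroup generated by the products `a • b` (finite sums `Σ aᵢ • bᵢ`). -/
def setSMul (A : Set R) (B : Set M) : AddSubgroup M := AddSubgroup.closure (smulSet A B)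

/-- The product `A B ⊆ R` of two sets of ring elements: the additive subgroup generated
by the products `a * b` (finite sums `Σ aᵢ bᵢ`). -/
def setMul (A B : Set R) : AddSubgroup R := AddSubgroup.closure (mulSet A B)

/-- The residual `(P :_{R_e} M_g) = {r ∈ R_e : r M_g ⊆ P}` of a subset `P` of `M_g`. -/
def colonRe (𝒜 : G → AddSubgroup R) (ℳ : G → AddSubgroup M) (g : G) (P : Set M) : Set R :=
  {r : R | r ∈ 𝒜 1 ∧ ∀ m ∈ ℳ g, r • m ∈ P}

/-- The residual `(P :_{M_g} r) = {m ∈ M_g : r • m ∈ P}`. -/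
def colonMg (ℳ : G → AddSubgroup M) (g : G) (P : Set M) (r : R) : Set M :=
  {m : M | m ∈ ℳ g ∧ r • m ∈ P}

/-- The residual `(A :_{R_e} r) = {s ∈ R_e : r * s ∈ A}` for `A ⊆ R_e`. -/
def colonReEl (𝒜 : G → AddSubgroup R) (A : Set R) (r : R) : Set R :=
  {s : R | s ∈ 𝒜 1 ∧ r * s ∈ A}

/-- `N_g` is a `g`-`I_e`-prime submodule of the `R_e`-module `M_g`. -/
def IsGIePrimeComp (𝒜 : G → AddSubgroup R) (ℳ : G → AddSubgroup M)
    (I : Ideal R) (N : Submodule R M) (g : G) : Prop :=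
  compG ℳ N g ≠ (ℳ g : Set M) ∧
    ∀ r ∈ 𝒜 (1 : G), ∀ m ∈ ℳ g, r • m ∈ compG ℳ N g →
      r • m ∉ setSMul (compE 𝒜 I) (compG ℳ N g) →
      m ∈ compG ℳ N g ∨ r ∈ colonRe 𝒜 ℳ g (compG ℳ N g)

/-- `N_g` is a `g`-prime submodule of the `R_e`-module `M_g`. -/
def IsGPrimeComp (𝒜 : G → AddSubgroup R) (ℳ : G → AddSubgroup M)
    (N : Submodule R M) (g : G) : Prop :=
  compG ℳ N g ≠ (ℳ g : Set M) ∧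
    ∀ r ∈ 𝒜 (1 : G), ∀ m ∈ ℳ g, r • m ∈ compG ℳ N g →
      m ∈ compG ℳ N g ∨ r ∈ colonRe 𝒜 ℳ g (compG ℳ N g)

/-- `J` is an ideal of the subring `R_e` (given as a subset of `R`). -/
def IsIdealOfRe (𝒜 : G → AddSubgroup R) (J : Set R) : Prop :=
  J ⊆ (𝒜 1 : Set R) ∧ (0 : R) ∈ J ∧ (∀ a ∈ J, ∀ b ∈ J, a + b ∈ J) ∧
    (∀ a ∈ J, -a ∈ J) ∧ ∀ r ∈ (𝒜 (1 : G) : Set R), ∀ a ∈ J, r * a ∈ J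

/-- `P` is an `R_e`-submodule of `M_g` (given as a subset of `M`). -/
def IsSubmoduleOfMg (𝒜 : G → AddSubgroup R) (ℳ : G → AddSubgroup M) (g : G)
    (P : Set M) : Prop :=
  P ⊆ (ℳ g : Set M) ∧ (0 : M) ∈ P ∧ (∀ a ∈ P, ∀ b ∈ P, a + b ∈ P) ∧
    (∀ a ∈ P, -a ∈ P) ∧ ∀ r ∈ (𝒜 (1 : G) : Set R), ∀ m ∈ P, r • m ∈ P

/-- `M_g` is a multiplication `R_e`-module: every `R_e`-submodule `P` of `M_g` is of
the form `J M_g` for some ideal `J` of `R_e`. -/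
def IsMultiplicationComp (𝒜 : G → AddSubgroup R) (ℳ : G → AddSubgroup M) (g : G) : Prop :=
  ∀ P : Set M, IsSubmoduleOfMg 𝒜 ℳ g P →
    ∃ J : Set R, IsIdealOfRe 𝒜 J ∧ P = (setSMul J (ℳ g : Set M) : Set M)

/-- `J` is an `e`-`I_e`-prime ideal of `R_e`. -/
def IsEIePrimeIdeal (𝒜 : G → AddSubgroup R) (I : Ideal R) (J : Set R) : Prop :=
  J ≠ (𝒜 (1 : G) : Set R) ∧
    ∀ r ∈ (𝒜 (1 : G) : Set R), ∀ s ∈ (𝒜 (1 : G) : Set R),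
      r * s ∈ J → r * s ∉ setMul (compE 𝒜 I) J → r ∈ J ∨ s ∈ J

/-- The radical `Gr(J)` of a subset `J` of `R_e`: those `r ∈ R_e` with `r ^ n ∈ J`
for some positive `n`. -/
def grRad (𝒜 : G → AddSubgroup R) (J : Set R) : Set R :=
  {r : R | r ∈ 𝒜 1 ∧ ∃ n : ℕ, 0 < n ∧ r ^ n ∈ J}


/-- `P` is a graded weakly prime submodule of the graded module `(M', ℳ')`. -/
def IsGradedWeaklyPrime {M' : Type*} [AddCommGroup M'] [Module R M']
    (𝒜 : G → AddSubgroup R) (ℳ' : G → AddSubgroup M') (P : Submodule R M') : Prop :=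
  P ≠ ⊤ ∧ ∀ r ∈ homog 𝒜, ∀ m ∈ homog ℳ', r • m ≠ 0 → r • m ∈ P →
    (∀ x : M', r • x ∈ P) ∨ m ∈ P

/-- If `N_g` is a `g`-`I_e`-prime submodule of `M_g`, then either
`N_g` is a `g`-prime submodule of `M_g` or `(N_g :_{R_e} M_g) N_g ⊆ I_e N_g`. -/
theorem gIePrimeComp_gPrime_or_colon_smul_le
    {G : Type*} [Group G] [DecidableEq G] {R : Type*} [CommRing R]
    {M : Type*} [AddCommGroup M] [Module R M]
    (𝒜 : G → AddSubgroup R) (ℳ : G → AddSubgroup M) (I : Ideal R) (N : Submodule R M)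
    (g : G) (hR : IsGradedRing 𝒜) (hM : IsGradedModule 𝒜 ℳ)
    (hI : IsGradedIdeal 𝒜 I) (hN : IsGradedSubmodule ℳ N)
    (hprime : IsGIePrimeComp 𝒜 ℳ I N g) :
    IsGPrimeComp 𝒜 ℳ N g ∨
      setSMul (colonRe 𝒜 ℳ g (compG ℳ N g)) (compG ℳ N g) ≤
        setSMul (compE 𝒜 I) (compG ℳ N g) := by
  obtain ⟨hne, hp⟩ := hprime
  set E := setSMul (compE 𝒜 I) (compG ℳ N g)
  refine or_iff_not_imp_right.mpr fun hnot => ⟨hne, fun r hr m hm hrm => ?_⟩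
  obtain ⟨a, ha, n, hn, han⟩ : ∃ a ∈ colonRe 𝒜 ℳ g (compG ℳ N g),
      ∃ n ∈ compG ℳ N g, a • n ∉ E := by
    by_contra! h
    refine hnot ((AddSubgroup.closure_le _).mpr ?_)
    rintro _ ⟨a, ha, n, hn, rfl⟩
    exact h a ha n hn
  have hsmul : ∀ s ∈ 𝒜 (1 : G), ∀ x ∈ compG ℳ N g, s • x ∈ compG ℳ N g :=
    fun s hs x hx => ⟨N.smul_mem s hx.1, by simpa using hM.2 hs hx.2⟩
  have hadd : ∀ x ∈ compG ℳ N g, ∀ y ∈ compG ℳ N g, x + y ∈ compG ℳ N g :=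
    fun x hx y hy => ⟨N.add_mem hx.1 hy.1, (ℳ g).add_mem hx.2 hy.2⟩
  have cancel_mem : m + n ∈ compG ℳ N g → m ∈ compG ℳ N g :=
    fun h => ⟨(N.add_mem_iff_left hn.1).mp h.1, hm⟩
  have cancel_colon : r + a ∈ colonRe 𝒜 ℳ g (compG ℳ N g) →
      r ∈ colonRe 𝒜 ℳ g (compG ℳ N g) := by
    refine fun h => ⟨hr, fun x hx => ⟨?_, by simpa using hM.2 hr hx⟩⟩
    have hx' := (h.2 x hx).1
    rw [add_smul] at hx'
    exact (N.add_mem_iff_left (ha.2 x hx).1).mp hx'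
  by_cases hrmE : r • m ∈ E
  swap
  · exact hp r hr m hm hrm hrmE
  have hmn := (ℳ g).add_mem hm hn.2
  have hra := (𝒜 1).add_mem hr ha.1
  by_cases hrn : r • n ∈ E
  swap
  · refine (hp r hr (m + n) hmn ?_ ?_).imp_left cancel_mem
    · rw [smul_add]
      exact hadd _ hrm _ (hsmul r hr n hn)
    · rwa [smul_add, add_mem_cancel_left hrmE]
  by_cases ham : a • m ∈ E
  swap
  · refine (hp (r + a) hra m hm ?_ ?_).imp_right cancel_colon
    · rw [add_smul]
      exact hadd _ hrm _ (ha.2 m hm)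
    · rwa [add_smul, add_mem_cancel_left hrmE]
  refine (hp (r + a) hra (m + n) hmn ?_ ?_).imp cancel_mem cancel_colon
  · rw [add_smul, smul_add]
    exact hadd _ (hadd _ hrm _ (hsmul r hr n hn)) _ (ha.2 _ hmn)
  · rwa [add_smul, smul_add, smul_add, add_mem_cancel_left (E.add_mem hrmE hrn),
      add_mem_cancel_left ham]
end GIePrime
end

section
/- Let G be a group with identity e, R a G-graded commutative ring with identity, M a graded R-module, N a graded submodule of M, and g ∈ G. If N_g = N ∩ M_g is a g-0-prime submodule of the R_e-module M_g (that is, a g-I_e-prime submodule with I = 0) such that (N_g :_{R_e} M_g) N_g ≠ 0, then N_g is a g-prime submodule of M_g. -/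
/- Common setup: a multiplicative group `G` with identity `1` (the paper's `e`),
a `G`-graded commutative ring `R` with grading `𝒜`, and a graded `R`-module `M`
with grading `ℳ`. -/

namespace GIePrime

variable {G : Type*} [Group G] {R : Type*} [CommRing R]
  {M : Type*} [AddCommGroup M] [Module R M]

/-- If `N_g` is a `g`-`0`-prime submodule of `M_g` (i.e. a
`g`-`I_e`-prime submodule with `I = 0`) such that `(N_g :_{R_e} M_g) N_g ≠ 0`, then
`N_g` is a `g`-prime submodule of `M_g`. -/
theorem gZeroPrimeComp_isGPrimeComp
    {G : Type*} [Group G] [DecidableEq G] {R : Type*} [CommRing R]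
    {M : Type*} [AddCommGroup M] [Module R M]
    (𝒜 : G → AddSubgroup R) (ℳ : G → AddSubgroup M) (N : Submodule R M)
    (g : G) (hR : IsGradedRing 𝒜) (hM : IsGradedModule 𝒜 ℳ)
    (hN : IsGradedSubmodule ℳ N)
    (hNgproper : compG ℳ N g ≠ (ℳ g : Set M))
    (hzeroprime : ∀ r ∈ 𝒜 (1 : G), ∀ m ∈ ℳ g, r • m ∈ compG ℳ N g → r • m ≠ 0 →
      m ∈ compG ℳ N g ∨ r ∈ colonRe 𝒜 ℳ g (compG ℳ N g))
    (hne : setSMul (colonRe 𝒜 ℳ g (compG ℳ N g)) (compG ℳ N g) ≠ ⊥) :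
    IsGPrimeComp 𝒜 ℳ N g := by
  refine ⟨hNgproper, fun r hr m hm hrm => ?_⟩
  by_contra! hcon
  obtain ⟨hmN, hrc⟩ := hcon
  have add_notMem : ∀ n ∈ compG ℳ N g, m + n ∉ compG ℳ N g := fun n hn h =>
    hmN ⟨(N.add_mem_iff_left hn.1).1 h.1, hm⟩
  have add_notMem_colon : ∀ a ∈ colonRe 𝒜 ℳ g (compG ℳ N g),
      r + a ∉ colonRe 𝒜 ℳ g (compG ℳ N g) := by
    refine fun a ha h => hrc ⟨hr, fun x hx => ?_⟩
    have h₁ := h.2 x hx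
    have h₂ := ha.2 x hx
    rw [add_smul] at h₁
    exact ⟨(N.add_mem_iff_left h₂.1).1 h₁.1, ((ℳ g).add_mem_cancel_right h₂.2).1 h₁.2⟩
  have smul_eq_zero_of : ∀ s ∈ 𝒜 (1 : G), ∀ x ∈ ℳ g, s • x ∈ compG ℳ N g →
      x ∉ compG ℳ N g → s ∉ colonRe 𝒜 ℳ g (compG ℳ N g) → s • x = 0 := by
    intro s hs x hx hsx hxN hsc
    by_contra h
    exact (hzeroprime s hs x hx hsx h).elim hxN hsc
  have hrm0 : r • m = 0 := smul_eq_zero_of r hr m hm hrm hmN hrc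
  have hrN : ∀ n ∈ compG ℳ N g, r • n = 0 := by
    intro n hn
    have hrn : r • n ∈ compG ℳ N g :=
      ⟨N.smul_mem r hn.1, by simpa using hM.2 hr hn.2⟩
    have heq : r • (m + n) = r • n := by rw [smul_add, hrm0, zero_add]
    rw [← heq] at hrn ⊢
    exact smul_eq_zero_of r hr _ ((ℳ g).add_mem hm hn.2) hrn (add_notMem n hn) hrc
  have hcm : ∀ a ∈ colonRe 𝒜 ℳ g (compG ℳ N g), a • m = 0 := by
    intro a ha
    have ham := ha.2 m hm
    have heq : (r + a) • m = a • m := by rw [add_smul, hrm0, zero_add]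
    rw [← heq] at ham ⊢
    exact smul_eq_zero_of _ ((𝒜 1).add_mem hr ha.1) m hm ham hmN (add_notMem_colon a ha)
  apply hne
  rw [setSMul, AddSubgroup.closure_eq_bot_iff]
  rintro _ ⟨a, ha, n, hn, rfl⟩
  have han := ha.2 n hn.2
  have heq : (r + a) • (m + n) = a • n := by
    rw [add_smul, smul_add, smul_add, hrm0, hrN n hn, hcm a ha, zero_add, zero_add, zero_add]
  rw [← heq] at han
  rw [Set.mem_singleton_iff, ← heq]
  exact smul_eq_zero_of _ ((𝒜 1).add_mem hr ha.1) _ ((ℳ g).add_mem hm hn.2) han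
    (add_notMem n hn) (add_notMem_colon a ha)
end GIePrime
end

section
/- Let G be a group with identity e, R a G-graded commutative ring with identity, M a graded R-module, I a graded ideal of R, N a graded submodule of M, and g ∈ G. If M_g is a multiplication R_e-module and N_g = N ∩ M_g is a g-I_e-prime submodule of M_g which is not a g-prime submodule of M_g, then N_g² ⊆ I_e N_g, where N_g² = (N_g :_{R_e} M_g)² M_g. -/
/- Common setup: a multiplicative group `G` with identity `1` (the paper's `e`),
a `G`-graded commutative ring `R` with grading `𝒜`, and a graded `R`-module `M`
with grading `ℳ`. -/

namespace GIePrime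

variable {G : Type*} [Group G] {R : Type*} [CommRing R]
  {M : Type*} [AddCommGroup M] [Module R M]

/-- If `N_g` is `g`-`I_e`-prime but not `g`-prime, then `(N_g :_{R_e} M_g) N_g ⊆ I_e N_g`. -/
theorem colonRe_smul_mem_of_not_isGPrimeComp [DecidableEq G]
    {𝒜 : G → AddSubgroup R} {ℳ : G → AddSubgroup M} {I : Ideal R} {N : Submodule R M} {g : G}
    (hM : IsGradedModule 𝒜 ℳ) (hprime : IsGIePrimeComp 𝒜 ℳ I N g)
    (hnot : ¬ IsGPrimeComp 𝒜 ℳ N g) {c : R} (hc : c ∈ colonRe 𝒜 ℳ g (compG ℳ N g))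
    {n : M} (hn : n ∈ compG ℳ N g) :
    c • n ∈ setSMul (compE 𝒜 I) (compG ℳ N g) := by
  obtain ⟨hne, hp⟩ := hprime
  simp only [IsGPrimeComp, not_and, not_forall, not_or] at hnot
  obtain ⟨r, hr, m, hm, hrm, hmN, hrC⟩ := hnot hne
  have smul_mem : ∀ {s : R} {x : M}, s ∈ 𝒜 1 → x ∈ ℳ g → s • x ∈ ℳ g := by
    intro s x hs hx
    simpa only [one_mul] using hM.2 hs hx
  -- Perturbing the failing pair `(r, m)` by the colon ideal and by `N_g` gives a failing pair.
  have key : ∀ d ∈ colonRe 𝒜 ℳ g (compG ℳ N g), ∀ y ∈ compG ℳ N g,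
      (r + d) • (m + y) ∈ setSMul (compE 𝒜 I) (compG ℳ N g) := by
    intro d hd y hy
    by_contra hE
    have hN : (r + d) • (m + y) ∈ compG ℳ N g := by
      refine ⟨?_, smul_mem (add_mem hr hd.1) (add_mem hm hy.2)⟩
      rw [smul_add, add_smul r d m]
      exact N.add_mem (N.add_mem hrm.1 (hd.2 m hm).1) (N.smul_mem _ hy.1)
    rcases hp _ (add_mem hr hd.1) _ (add_mem hm hy.2) hN hE with h | h
    · exact hmN ⟨(N.add_mem_iff_left hy.1).1 h.1, hm⟩
    · refine hrC ⟨hr, fun x hx => ⟨?_, smul_mem hr hx⟩⟩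
      have hsum := (h.2 x hx).1
      rw [add_smul] at hsum
      exact (N.add_mem_iff_left (hd.2 x hx).1).1 hsum
  have h0C : (0 : R) ∈ colonRe 𝒜 ℳ g (compG ℳ N g) :=
    ⟨zero_mem _, fun x _ => by
      rw [zero_smul]
      exact ⟨N.zero_mem, zero_mem _⟩⟩
  have h0N : (0 : M) ∈ compG ℳ N g := ⟨N.zero_mem, zero_mem _⟩
  have expand : c • n = (r + c) • (m + n) - (r + c) • (m + 0)
      - ((r + 0) • (m + n) - (r + 0) • (m + 0)) := by
    module
  rw [expand]
  exact sub_mem (sub_mem (key c hc n hn) (key c hc 0 h0N))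
    (sub_mem (key 0 h0C n hn) (key 0 h0C 0 h0N))

/-- If `M_g` is a multiplication `R_e`-module and `N_g` is a
`g`-`I_e`-prime submodule of `M_g` which is not a `g`-prime submodule, then
`N_g² = (N_g :_{R_e} M_g)² M_g ⊆ I_e N_g`. -/
theorem gIePrimeComp_not_gPrime_sq_le
    {G : Type*} [Group G] [DecidableEq G] {R : Type*} [CommRing R]
    {M : Type*} [AddCommGroup M] [Module R M]
    (𝒜 : G → AddSubgroup R) (ℳ : G → AddSubgroup M) (I : Ideal R) (N : Submodule R M)
    (g : G) (hR : IsGradedRing 𝒜) (hM : IsGradedModule 𝒜 ℳ)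
    (hI : IsGradedIdeal 𝒜 I) (hN : IsGradedSubmodule ℳ N)
    (hmul : IsMultiplicationComp 𝒜 ℳ g)
    (hprime : IsGIePrimeComp 𝒜 ℳ I N g)
    (hnot : ¬ IsGPrimeComp 𝒜 ℳ N g) :
    setSMul (mulSet (colonRe 𝒜 ℳ g (compG ℳ N g)) (colonRe 𝒜 ℳ g (compG ℳ N g)))
        (ℳ g : Set M) ≤
      setSMul (compE 𝒜 I) (compG ℳ N g) := by
  refine (AddSubgroup.closure_le _).2 ?_
  rintro _ ⟨_, ⟨a, ha, b, hb, rfl⟩, x, hx, rfl⟩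
  rw [mul_smul]
  exact colonRe_smul_mem_of_not_isGPrimeComp hM hprime hnot ha (hb.2 x hx)
end GIePrime
end

section
/- Let G be a group with identity e, R a G-graded commutative ring with identity, M a graded R-module, I a graded ideal of R, and N a proper graded submodule of M. Then N is a graded I_e-prime submodule of M if and only if N/I_eN is a graded weakly prime submodule of the graded R-module M/I_eN. -/
/- Common setup: a multiplicative group `G` with identity `1` (the paper's `e`),
a `G`-graded commutative ring `R` with grading `𝒜`, and a graded `R`-module `M`
with grading `ℳ`. -/

namespace GIePrime

variable {G : Type*} [Group G] {R : Type*} [CommRing R]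
  {M : Type*} [AddCommGroup M] [Module R M]

theorem ieSmul_le (𝒜 : G → AddSubgroup R) (I : Ideal R) (N : Submodule R M) :
    ieSmul 𝒜 I N ≤ N :=
  Submodule.smul_le_right

theorem mkQ_mem_map_mkQ_iff {E N : Submodule R M} (h : E ≤ N) (x : M) :
    E.mkQ x ∈ N.map E.mkQ ↔ x ∈ N := by
  rw [← Submodule.mem_comap, Submodule.comap_map_mkQ, sup_eq_right.mpr h]

theorem map_mkQ_eq_top_iff {E N : Submodule R M} (h : E ≤ N) :
    N.map E.mkQ = ⊤ ↔ N = ⊤ := by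
  simp only [Submodule.eq_top_iff', E.mkQ_surjective.forall, mkQ_mem_map_mkQ_iff h]

theorem homog_map {ι M' : Type*} [AddCommGroup M'] (ℳ : ι → AddSubgroup M) (f : M →+ M') :
    homog (fun g => (ℳ g).map f) = f '' homog ℳ := by
  simp [homog, Set.image_iUnion]

/-- `N` is a graded `I_e`-prime submodule of `M` iff `N/I_eN` is a
graded weakly prime submodule of `M/I_eN`. -/
theorem gradedIePrime_iff_quotient_weaklyPrime
    {G : Type*} [Group G] [DecidableEq G] {R : Type*} [CommRing R]
    {M : Type*} [AddCommGroup M] [Module R M]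
    (𝒜 : G → AddSubgroup R) (ℳ : G → AddSubgroup M) (I : Ideal R) (N : Submodule R M)
    (hR : IsGradedRing 𝒜) (hM : IsGradedModule 𝒜 ℳ)
    (hI : IsGradedIdeal 𝒜 I) (hN : IsGradedSubmodule ℳ N) (hNproper : N ≠ ⊤) :
    IsGradedIePrime 𝒜 ℳ I N ↔
      IsGradedWeaklyPrime 𝒜
        (fun g => (ℳ g).map (ieSmul 𝒜 I N).mkQ.toAddMonoidHom)
        (N.map (ieSmul 𝒜 I N).mkQ) := by
  have h := ieSmul_le 𝒜 I N
  unfold IsGradedIePrime IsIePrimeSub IsGradedWeaklyPrime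
  rw [homog_map]
  refine and_congr (map_mkQ_eq_top_iff h).not.symm (forall₂_congr fun r _ => ?_)
  rw [Set.forall_mem_image]
  refine forall₂_congr fun m _ => ?_
  simp only [LinearMap.toAddMonoidHom_coe, (ieSmul 𝒜 I N).mkQ_surjective.forall, ← map_smul,
    mkQ_mem_map_mkQ_iff h]
  rw [Ne, Submodule.mkQ_apply, Submodule.Quotient.mk_eq_zero]
  exact forall_comm
end GIePrime
end

section
/- Let G be a group with identity e, R a G-graded commutative ring with identity, M a graded R-module, I a graded ideal of R, N a graded submodule of M, and g ∈ G such that (I_e N_g :_{R_e} M_g) = I_e (N_g :_{R_e} M_g). If N_g = N ∩ M_g is a g-I_e-prime submodule of M_g, then (N_g :_{R_e} M_g) is an e-I_e-prime ideal of R_e. -/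
/- Common setup: a multiplicative group `G` with identity `1` (the paper's `e`),
a `G`-graded commutative ring `R` with grading `𝒜`, and a graded `R`-module `M`
with grading `ℳ`. -/

namespace GIePrime

variable {G : Type*} [Group G] {R : Type*} [CommRing R]
  {M : Type*} [AddCommGroup M] [Module R M]

/-- Suppose `(I_e N_g :_{R_e} M_g) = I_e (N_g :_{R_e} M_g)`.  If
`N_g` is a `g`-`I_e`-prime submodule of `M_g`, then `(N_g :_{R_e} M_g)` is an
`e`-`I_e`-prime ideal of `R_e`. -/
theorem gIePrimeComp_colon_isEIePrimeIdeal
    {G : Type*} [Group G] [DecidableEq G] {R : Type*} [CommRing R]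
    {M : Type*} [AddCommGroup M] [Module R M]
    (𝒜 : G → AddSubgroup R) (ℳ : G → AddSubgroup M) (I : Ideal R) (N : Submodule R M)
    (g : G) (hR : IsGradedRing 𝒜) (hM : IsGradedModule 𝒜 ℳ)
    (hI : IsGradedIdeal 𝒜 I) (hN : IsGradedSubmodule ℳ N)
    (hcolon : colonRe 𝒜 ℳ g (setSMul (compE 𝒜 I) (compG ℳ N g) : Set M) =
      (setMul (compE 𝒜 I) (colonRe 𝒜 ℳ g (compG ℳ N g)) : Set R))
    (hprime : IsGIePrimeComp 𝒜 ℳ I N g) :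
    IsEIePrimeIdeal 𝒜 I (colonRe 𝒜 ℳ g (compG ℳ N g)) := by
  obtain ⟨-, h1, -⟩ := hR
  obtain ⟨-, hsmul⟩ := hM
  obtain ⟨hne, hp⟩ := hprime
  refine ⟨fun h => hne ?_, ?_⟩
  · have h1J : (1 : R) ∈ colonRe 𝒜 ℳ g (compG ℳ N g) := h ▸ h1
    refine Set.Subset.antisymm Set.inter_subset_right fun m hm => ?_
    simpa using h1J.2 m hm
  · intro r hr s hs hrs hrsE
    by_contra! hcon
    obtain ⟨hrJ, hsJ⟩ := hcon
    have hsM : ∀ m ∈ ℳ g, s • m ∈ ℳ g := fun m hm => by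
      simpa using hsmul hs hm
    have key : ∀ m ∈ ℳ g, (r * s) • m ∉ setSMul (compE 𝒜 I) (compG ℳ N g) →
        s • m ∈ compG ℳ N g := fun m hm hmE =>
      (hp r hr (s • m) (hsM m hm) (smul_smul r s m ▸ hrs.2 m hm)
        (by rwa [smul_smul])).resolve_right hrJ
    obtain ⟨m₀, hm₀, hm₀E⟩ : ∃ m ∈ ℳ g,
        (r * s) • m ∉ setSMul (compE 𝒜 I) (compG ℳ N g) := by
      by_contra! hall
      exact hrsE (hcolon.subset ⟨hrs.1, hall⟩)
    refine hsJ ⟨hs, fun m hm => ?_⟩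
    by_cases hmE : (r * s) • m ∈ setSMul (compE 𝒜 I) (compG ℳ N g)
    · have hsum : s • (m₀ + m) ∈ compG ℳ N g :=
        key _ (add_mem hm₀ hm) fun h =>
          hm₀E ((AddSubgroup.add_mem_cancel_right _ hmE).1 (smul_add (r * s) m₀ m ▸ h))
      rw [smul_add] at hsum
      exact ⟨(N.add_mem_iff_right (key m₀ hm₀ hm₀E).1).1 hsum.1, hsM m hm⟩
    · exact key m hm hmE
end GIePrime
end

section
/- Let G be a group with identity e, R a G-graded commutative ring with identity, I a graded ideal of R, and J a proper graded ideal of R with e-component J_e = J ∩ R_e. Then the following are equivalent: (i) J_e is an e-I_e-prime ideal of R_e; (ii) for every r_e ∈ R_e − J_e, (J_e :_{R_e} r_e) = J_e ∪ (I_e J_e :_{R_e} r_e); (iii) for every r_e ∈ R_e − J_e, either (J_e :_{R_e} r_e) = J_e or (J_e :_{R_e} r_e) = (I_e J_e :_{R_e} r_e); (iv) for any two graded ideals K and L of R with K_e L_e ⊆ J_e and K_e L_e ⊄ I_e J_e, either K_e ⊆ J_e or L_e ⊆ J_e. -/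
/- Common setup: a multiplicative group `G` with identity `1` (the paper's `e`),
a `G`-graded commutative ring `R` with grading `𝒜`, and a graded `R`-module `M`
with grading `ℳ`. -/

namespace GIePrime

variable {G : Type*} [Group G] {R : Type*} [CommRing R]
  {M : Type*} [AddCommGroup M] [Module R M]

theorem IsGradedRing.mul_mem_one [DecidableEq G] {𝒜 : G → AddSubgroup R} (hR : IsGradedRing 𝒜)
    {a b : R} (ha : a ∈ 𝒜 1) (hb : b ∈ 𝒜 1) : a * b ∈ 𝒜 1 := by
  simpa using hR.2.2 ha hb

/-- A principal ideal generated by an element of degree `e` is graded. -/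
theorem isGradedIdeal_span_singleton [DecidableEq G] {𝒜 : G → AddSubgroup R}
    (hR : IsGradedRing 𝒜) {r : R} (hr : r ∈ 𝒜 1) : IsGradedIdeal 𝒜 (Ideal.span {r}) := by
  refine le_antisymm (iSup_le fun g => inf_le_left) fun x hx => ?_
  obtain ⟨a, rfl⟩ := Ideal.mem_span_singleton'.1 hx
  let := hR.1.chooseDecomposition
  clear hx
  induction a using DirectSum.Decomposition.inductionOn 𝒜 with
  | zero => simp
  | @homogeneous g b =>
    refine AddSubgroup.mem_iSup_of_mem g ⟨Ideal.mem_span_singleton'.2 ⟨b, rfl⟩, ?_⟩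
    simpa using hR.2.2 b.2 hr
  | add b c hb hc =>
    rw [add_mul]
    exact add_mem hb hc

/-- The `e`-component of the principal ideal generated by `r ∈ R_e` is `R_e r`. -/
theorem exists_eq_mul_of_mem_compE_span_singleton [DecidableEq G] {𝒜 : G → AddSubgroup R}
    (hR : IsGradedRing 𝒜) {r x : R} (hr : r ∈ 𝒜 1) (hx : x ∈ compE 𝒜 (Ideal.span {r})) :
    ∃ a ∈ 𝒜 1, x = a * r := by
  let := hR.1.chooseDecomposition
  have key : ∀ a : R, (DirectSum.decompose 𝒜 (a * r) 1 : R) =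
      (DirectSum.decompose 𝒜 a 1 : R) * r := by
    intro a
    induction a using DirectSum.Decomposition.inductionOn 𝒜 with
    | zero => simp
    | @homogeneous g b =>
      have hbr : (b : R) * r ∈ 𝒜 g := by simpa using hR.2.2 b.2 hr
      by_cases hg : g = 1
      · subst hg
        rw [DirectSum.decompose_of_mem_same 𝒜 hbr, DirectSum.decompose_of_mem_same 𝒜 b.2]
      · rw [DirectSum.decompose_of_mem_ne 𝒜 hbr hg, DirectSum.decompose_of_mem_ne 𝒜 b.2 hg,
          zero_mul]
    | add b c hb hc => simp [add_mul, DirectSum.decompose_add, hb, hc]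
  obtain ⟨a, rfl⟩ := Ideal.mem_span_singleton'.1 hx.1
  exact ⟨_, (DirectSum.decompose 𝒜 a 1).2, by
    rw [← key, DirectSum.decompose_of_mem_same 𝒜 hx.2]⟩

theorem setMul_compE_subset [DecidableEq G] {𝒜 : G → AddSubgroup R} (hR : IsGradedRing 𝒜)
    (I J : Ideal R) : (setMul (compE 𝒜 I) (compE 𝒜 J) : Set R) ⊆ compE 𝒜 J := by
  refine (AddSubgroup.closure_le (J.toAddSubgroup ⊓ 𝒜 1)).2 ?_
  rintro _ ⟨i, hi, j, hj, rfl⟩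
  exact ⟨J.mul_mem_left i hj.1, hR.mul_mem_one hi.2 hj.2⟩

theorem colonReEl_eq_union [DecidableEq G] {𝒜 : G → AddSubgroup R} (hR : IsGradedRing 𝒜)
    {I J : Ideal R} (h : IsEIePrimeIdeal 𝒜 I (compE 𝒜 J)) {r : R} (hr : r ∈ 𝒜 1)
    (hrJ : r ∉ compE 𝒜 J) :
    colonReEl 𝒜 (compE 𝒜 J) r =
      compE 𝒜 J ∪ colonReEl 𝒜 (setMul (compE 𝒜 I) (compE 𝒜 J) : Set R) r := by
  ext s
  constructor
  · rintro ⟨hs, hrs⟩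
    by_cases hQ : r * s ∈ setMul (compE 𝒜 I) (compE 𝒜 J)
    · exact Or.inr ⟨hs, hQ⟩
    · exact Or.inl ((h.2 r hr s hs hrs hQ).resolve_left hrJ)
  · rintro (hs | ⟨hs, hrs⟩)
    · exact ⟨hs.2, J.mul_mem_left r hs.1, hR.mul_mem_one hr hs.2⟩
    · exact ⟨hs, setMul_compE_subset hR I J hrs⟩

theorem colonReEl_eq_or_eq_of_eq_union {𝒜 : G → AddSubgroup R} {I J : Ideal R}
    {r : R} (h : colonReEl 𝒜 (compE 𝒜 J) r =
      compE 𝒜 J ∪ colonReEl 𝒜 (setMul (compE 𝒜 I) (compE 𝒜 J) : Set R) r) :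
    colonReEl 𝒜 (compE 𝒜 J) r = compE 𝒜 J ∨
      colonReEl 𝒜 (compE 𝒜 J) r =
        colonReEl 𝒜 (setMul (compE 𝒜 I) (compE 𝒜 J) : Set R) r := by
  by_cases hsub : colonReEl 𝒜 (compE 𝒜 J) r ⊆ compE 𝒜 J
  · exact Or.inl (hsub.antisymm (h ▸ Set.subset_union_left))
  · right
    obtain ⟨t, ht, htJ⟩ := Set.not_subset.1 hsub
    have hmem : ∀ s ∈ colonReEl 𝒜 (compE 𝒜 J) r, s ∉ compE 𝒜 J →
        r * s ∈ setMul (compE 𝒜 I) (compE 𝒜 J) := fun s hs hsJ =>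
      ((h.subset hs).resolve_left hsJ).2
    refine Set.Subset.antisymm (fun s hs => ⟨hs.1, ?_⟩) (h ▸ Set.subset_union_right)
    by_cases hsJ : s ∈ compE 𝒜 J
    · have hst : s + t ∈ colonReEl 𝒜 (compE 𝒜 J) r := by
        refine ⟨add_mem hs.1 ht.1, ?_⟩
        rw [mul_add]
        exact ⟨add_mem hs.2.1 ht.2.1, add_mem hs.2.2 ht.2.2⟩
      have hstJ : s + t ∉ compE 𝒜 J := fun hc =>
        htJ ⟨(J.add_mem_iff_right hsJ.1).1 hc.1, ht.1⟩
      have := hmem _ hst hstJ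
      rw [mul_add] at this
      exact (add_mem_cancel_right (hmem t ht htJ)).1 this
    · exact hmem s hs hsJ

theorem subset_or_subset_of_colonReEl {𝒜 : G → AddSubgroup R} {I J : Ideal R}
    (h : ∀ r ∈ (𝒜 (1 : G) : Set R), r ∉ compE 𝒜 J →
      colonReEl 𝒜 (compE 𝒜 J) r = compE 𝒜 J ∨
        colonReEl 𝒜 (compE 𝒜 J) r =
          colonReEl 𝒜 (setMul (compE 𝒜 I) (compE 𝒜 J) : Set R) r)
    {K L : Ideal R} (hKL : (setMul (compE 𝒜 K) (compE 𝒜 L) : Set R) ⊆ compE 𝒜 J)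
    (hKLI : ¬ ((setMul (compE 𝒜 K) (compE 𝒜 L) : Set R) ⊆
      (setMul (compE 𝒜 I) (compE 𝒜 J) : Set R))) :
    compE 𝒜 K ⊆ compE 𝒜 J ∨ compE 𝒜 L ⊆ compE 𝒜 J := by
  by_contra! hcon
  obtain ⟨hK, hL⟩ := hcon
  obtain ⟨t, htL, htJ⟩ := Set.not_subset.1 hL
  obtain ⟨u, huK, huJ⟩ := Set.not_subset.1 hK
  have hmul : ∀ r ∈ compE 𝒜 K, ∀ s ∈ compE 𝒜 L, r * s ∈ compE 𝒜 J := fun r hr s hs =>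
    hKL (AddSubgroup.subset_closure ⟨r, hr, s, hs, rfl⟩)
  have hout : ∀ r ∈ compE 𝒜 K, r ∉ compE 𝒜 J → ∀ s ∈ compE 𝒜 L,
      r * s ∈ setMul (compE 𝒜 I) (compE 𝒜 J) := by
    intro r hr hrJ s hs
    rcases h r hr.2 hrJ with h' | h'
    · exact absurd (h'.subset ⟨htL.2, hmul r hr t htL⟩) htJ
    · exact (h'.subset ⟨hs.2, hmul r hr s hs⟩).2
  refine hKLI ((AddSubgroup.closure_le _).2 ?_)
  rintro _ ⟨r, hr, s, hs, rfl⟩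
  by_cases hrJ : r ∈ compE 𝒜 J
  · have hru := hout (r + u) ⟨add_mem hr.1 huK.1, add_mem hr.2 huK.2⟩
      (fun hc => huJ ⟨(J.add_mem_iff_right hrJ.1).1 hc.1, huK.2⟩) s hs
    rw [add_mul] at hru
    exact (add_mem_cancel_right (hout u huK huJ s hs)).1 hru
  · exact hout r hr hrJ s hs

theorem compE_ne_of_ne_top [DecidableEq G] {𝒜 : G → AddSubgroup R} (hR : IsGradedRing 𝒜)
    {J : Ideal R} (hJ : J ≠ ⊤) : compE 𝒜 J ≠ (𝒜 (1 : G) : Set R) := fun h =>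
  hJ ((Ideal.eq_top_iff_one J).2 (h.superset hR.2.1).1)

theorem isEIePrimeIdeal_of_subset_or_subset [DecidableEq G] {𝒜 : G → AddSubgroup R}
    (hR : IsGradedRing 𝒜) {I J : Ideal R} (hJ : J ≠ ⊤)
    (h : ∀ K L : Ideal R, IsGradedIdeal 𝒜 K → IsGradedIdeal 𝒜 L →
      (setMul (compE 𝒜 K) (compE 𝒜 L) : Set R) ⊆ compE 𝒜 J →
      ¬ ((setMul (compE 𝒜 K) (compE 𝒜 L) : Set R) ⊆
          (setMul (compE 𝒜 I) (compE 𝒜 J) : Set R)) →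
      compE 𝒜 K ⊆ compE 𝒜 J ∨ compE 𝒜 L ⊆ compE 𝒜 J) :
    IsEIePrimeIdeal 𝒜 I (compE 𝒜 J) := by
  refine ⟨compE_ne_of_ne_top hR hJ, fun r hr s hs hrs hrsI => ?_⟩
  have hself : ∀ x ∈ 𝒜 1, x ∈ compE 𝒜 (Ideal.span {x}) := fun x hx =>
    ⟨Ideal.mem_span_singleton_self x, hx⟩
  refine (h _ _ (isGradedIdeal_span_singleton hR hr) (isGradedIdeal_span_singleton hR hs)
    ?_ ?_).imp (fun h' => h' (hself r hr)) (fun h' => h' (hself s hs))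
  · refine (AddSubgroup.closure_le (J.toAddSubgroup ⊓ 𝒜 1)).2 ?_
    rintro _ ⟨x, hx, y, hy, rfl⟩
    obtain ⟨a, ha, rfl⟩ := exists_eq_mul_of_mem_compE_span_singleton hR hr hx
    obtain ⟨b, hb, rfl⟩ := exists_eq_mul_of_mem_compE_span_singleton hR hs hy
    rw [mul_mul_mul_comm]
    exact ⟨J.mul_mem_left _ hrs.1, hR.mul_mem_one (hR.mul_mem_one ha hb) hrs.2⟩
  · exact fun hsub => hrsI (hsub (AddSubgroup.subset_closure
      ⟨r, hself r hr, s, hself s hs, rfl⟩))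

/-- For a proper graded ideal `J` of `R`, the following are
equivalent: (i) `J_e` is an `e`-`I_e`-prime ideal of `R_e`; (ii) for every
`r_e ∈ R_e - J_e`, `(J_e :_{R_e} r_e) = J_e ∪ (I_e J_e :_{R_e} r_e)`; (iii) for every
`r_e ∈ R_e - J_e`, `(J_e :_{R_e} r_e) = J_e` or `(J_e :_{R_e} r_e) = (I_e J_e :_{R_e} r_e)`;
(iv) for any graded ideals `K`, `L` of `R` with `K_e L_e ⊆ J_e` and
`K_e L_e ⊄ I_e J_e`, either `K_e ⊆ J_e` or `L_e ⊆ J_e`. -/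
theorem eIePrimeIdeal_tfae
    {G : Type*} [Group G] [DecidableEq G] {R : Type*} [CommRing R]
    (𝒜 : G → AddSubgroup R) (I J : Ideal R)
    (hR : IsGradedRing 𝒜) (hI : IsGradedIdeal 𝒜 I)
    (hJ : IsGradedIdeal 𝒜 J) (hJproper : J ≠ ⊤) :
    (IsEIePrimeIdeal 𝒜 I (compE 𝒜 J) ↔
      (∀ r ∈ (𝒜 (1 : G) : Set R), r ∉ compE 𝒜 J →
        colonReEl 𝒜 (compE 𝒜 J) r =
          compE 𝒜 J ∪ colonReEl 𝒜 (setMul (compE 𝒜 I) (compE 𝒜 J) : Set R) r)) ∧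
    ((∀ r ∈ (𝒜 (1 : G) : Set R), r ∉ compE 𝒜 J →
        colonReEl 𝒜 (compE 𝒜 J) r =
          compE 𝒜 J ∪ colonReEl 𝒜 (setMul (compE 𝒜 I) (compE 𝒜 J) : Set R) r) ↔
      (∀ r ∈ (𝒜 (1 : G) : Set R), r ∉ compE 𝒜 J →
        colonReEl 𝒜 (compE 𝒜 J) r = compE 𝒜 J ∨
          colonReEl 𝒜 (compE 𝒜 J) r =
            colonReEl 𝒜 (setMul (compE 𝒜 I) (compE 𝒜 J) : Set R) r)) ∧
    ((∀ r ∈ (𝒜 (1 : G) : Set R), r ∉ compE 𝒜 J →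
        colonReEl 𝒜 (compE 𝒜 J) r = compE 𝒜 J ∨
          colonReEl 𝒜 (compE 𝒜 J) r =
            colonReEl 𝒜 (setMul (compE 𝒜 I) (compE 𝒜 J) : Set R) r) ↔
      (∀ K L : Ideal R, IsGradedIdeal 𝒜 K → IsGradedIdeal 𝒜 L →
        (setMul (compE 𝒜 K) (compE 𝒜 L) : Set R) ⊆ compE 𝒜 J →
        ¬ ((setMul (compE 𝒜 K) (compE 𝒜 L) : Set R) ⊆
            (setMul (compE 𝒜 I) (compE 𝒜 J) : Set R)) →
        compE 𝒜 K ⊆ compE 𝒜 J ∨ compE 𝒜 L ⊆ compE 𝒜 J)) := by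
  have union_imp_prime : (∀ r ∈ (𝒜 (1 : G) : Set R), r ∉ compE 𝒜 J →
        colonReEl 𝒜 (compE 𝒜 J) r =
          compE 𝒜 J ∪ colonReEl 𝒜 (setMul (compE 𝒜 I) (compE 𝒜 J) : Set R) r) →
      IsEIePrimeIdeal 𝒜 I (compE 𝒜 J) := fun h =>
    ⟨compE_ne_of_ne_top hR hJproper, fun r hr s hs hrs hrsI => or_iff_not_imp_left.2 fun hrJ =>
      ((h r hr hrJ).subset ⟨hs, hrs⟩).resolve_right fun h' => hrsI h'.2⟩
  refine ⟨⟨fun h r hr hrJ => colonReEl_eq_union hR h hr hrJ, union_imp_prime⟩,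
    ⟨fun h r hr hrJ => colonReEl_eq_or_eq_of_eq_union (h r hr hrJ), fun h r hr hrJ => ?_⟩,
    ⟨fun h K L _ _ hKL hKLI => subset_or_subset_of_colonReEl h hKL hKLI, fun h r hr hrJ =>
      colonReEl_eq_or_eq_of_eq_union
        (colonReEl_eq_union hR (isEIePrimeIdeal_of_subset_or_subset hR hJproper h) hr hrJ)⟩⟩
  exact colonReEl_eq_union hR (isEIePrimeIdeal_of_subset_or_subset hR hJproper
    fun K L _ _ hKL hKLI => subset_or_subset_of_colonReEl h hKL hKLI) hr hrJ
end GIePrime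
end

section
/- Let G be a group with identity e, R a G-graded commutative ring with identity, M a graded R-module, I a graded ideal of R, N a proper graded submodule of M, and g ∈ G such that (I_e N_g :_{R_e} M_g) = I_e (N_g :_{R_e} M_g). If N_g = N ∩ M_g is a g-I_e-prime submodule of M_g and M_g is a multiplication R_e-module, then for any graded submodules K and L of M with K_g L_g ⊆ N_g and K_g L_g ⊄ I_e N_g, either K_g ⊆ N_g or L_g ⊆ N_g, where K_g L_g = (K_g :_{R_e} M_g)(L_g :_{R_e} M_g)M_g. -/
/- Common setup: a multiplicative group `G` with identity `1` (the paper's `e`),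
a `G`-graded commutative ring `R` with grading `𝒜`, and a graded `R`-module `M`
with grading `ℳ`. -/

namespace GIePrime

variable {G : Type*} [Group G] {R : Type*} [CommRing R]
  {M : Type*} [AddCommGroup M] [Module R M]

theorem add_mem_colonRe_compG {𝒜 : G → AddSubgroup R} {ℳ : G → AddSubgroup M}
    {N : Submodule R M} {g : G} {r s : R} (hr : r ∈ colonRe 𝒜 ℳ g (compG ℳ N g))
    (hs : s ∈ colonRe 𝒜 ℳ g (compG ℳ N g)) :
    r + s ∈ colonRe 𝒜 ℳ g (compG ℳ N g) := by
  refine ⟨add_mem hr.1 hs.1, fun m hm => ?_⟩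
  rw [add_smul]
  exact ⟨add_mem (hr.2 m hm).1 (hs.2 m hm).1, add_mem (hr.2 m hm).2 (hs.2 m hm).2⟩

theorem neg_mem_colonRe_compG {𝒜 : G → AddSubgroup R} {ℳ : G → AddSubgroup M}
    {N : Submodule R M} {g : G} {r : R} (hr : r ∈ colonRe 𝒜 ℳ g (compG ℳ N g)) :
    -r ∈ colonRe 𝒜 ℳ g (compG ℳ N g) := by
  refine ⟨neg_mem hr.1, fun m hm => ?_⟩
  rw [neg_smul]
  exact ⟨neg_mem (hr.2 m hm).1, neg_mem (hr.2 m hm).2⟩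

/-- If `A` and `B` are closed under addition and neither is contained in `P`, which is closed
under addition and negation, then `(a * b) • m ∈ E` for all `a ∈ A` and `b ∈ B` as soon as it
holds for those `a` and `b` outside `P`. -/
theorem mul_smul_mem_of_forall_notMem {A B P : Set R} {E : AddSubgroup M} {m : M}
    (hA : ∀ a ∈ A, ∀ a' ∈ A, a + a' ∈ A) (hB : ∀ b ∈ B, ∀ b' ∈ B, b + b' ∈ B)
    (hPadd : ∀ p ∈ P, ∀ q ∈ P, p + q ∈ P) (hPneg : ∀ p ∈ P, -p ∈ P)
    (hAP : ¬ A ⊆ P) (hBP : ¬ B ⊆ P)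
    (h : ∀ a ∈ A, a ∉ P → ∀ b ∈ B, b ∉ P → (a * b) • m ∈ E) :
    ∀ a ∈ A, ∀ b ∈ B, (a * b) • m ∈ E := by
  obtain ⟨a', ha', ha'P⟩ := Set.not_subset.1 hAP
  obtain ⟨b', hb', hb'P⟩ := Set.not_subset.1 hBP
  have add_notMem {p q : R} (hp : p ∈ P) (hq : q ∉ P) : p + q ∉ P := fun hpq =>
    hq (by simpa using hPadd _ (hPneg p hp) _ hpq)
  have hleft : ∀ a ∈ A, ∀ b ∈ B, b ∉ P → (a * b) • m ∈ E := by
    intro a ha b hb hbP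
    by_cases haP : a ∈ P
    · have hsum := h _ (hA a ha a' ha') (add_notMem haP ha'P) b hb hbP
      rw [add_mul, add_smul] at hsum
      exact (AddSubgroup.add_mem_cancel_right E (h a' ha' ha'P b hb hbP)).1 hsum
    · exact h a ha haP b hb hbP
  intro a ha b hb
  by_cases hbP : b ∈ P
  · have hsum := hleft a ha _ (hB b hb b' hb') (add_notMem hbP hb'P)
    rw [mul_add, add_smul] at hsum
    exact (AddSubgroup.add_mem_cancel_right E (hleft a ha b' hb' hb'P)).1 hsum
  · exact hleft a ha b hb hbP

/-- For a `g`-`I_e`-prime `N_g`, if `a b M_g ⊆ N_g` with `a` and `b` in `R_e` outside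
`(N_g :_{R_e} M_g)`, then `a b M_g ⊆ I_e N_g`. -/
theorem IsGIePrimeComp.mul_smul_mem {𝒜 : G → AddSubgroup R} {ℳ : G → AddSubgroup M}
    {I : Ideal R} {N : Submodule R M} {g : G} (hprime : IsGIePrimeComp 𝒜 ℳ I N g)
    {a b : R} (ha : a ∈ 𝒜 1) (hb : b ∈ 𝒜 1) (hbM : ∀ m ∈ ℳ g, b • m ∈ ℳ g)
    (haN : a ∉ colonRe 𝒜 ℳ g (compG ℳ N g)) (hbN : b ∉ colonRe 𝒜 ℳ g (compG ℳ N g))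
    (hab : ∀ m ∈ ℳ g, (a * b) • m ∈ compG ℳ N g) {m : M} (hm : m ∈ ℳ g) :
    (a * b) • m ∈ setSMul (compE 𝒜 I) (compG ℳ N g) := by
  have key : ∀ x ∈ ℳ g, b • x ∉ N → (a * b) • x ∈ setSMul (compE 𝒜 I) (compG ℳ N g) := by
    intro x hx hxN
    by_contra hxE
    have hxab := hab x hx
    rw [mul_smul] at hxab hxE
    rcases hprime.2 a ha (b • x) (hbM x hx) hxab hxE with h | h
    · exact hxN h.1
    · exact haN h
  by_cases hmN : b • m ∈ N
  · obtain ⟨x, hx, hxN⟩ : ∃ x ∈ ℳ g, b • x ∉ N := by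
      by_contra! hall
      exact hbN ⟨hb, fun x hx => ⟨hall x hx, hbM x hx⟩⟩
    have hsum := key (m + x) (add_mem hm hx) fun h => hxN <| by
      rw [smul_add] at h
      exact (Submodule.add_mem_iff_right N hmN).1 h
    rw [smul_add] at hsum
    exact (AddSubgroup.add_mem_cancel_right _ (key x hx hxN)).1 hsum
  · exact key m hm hmN

/-- In a multiplication module, components of submodules are compared by their residuals. -/
theorem compG_subset_of_colonRe_subset [DecidableEq G] {𝒜 : G → AddSubgroup R}
    {ℳ : G → AddSubgroup M} {g : G} (hM : IsGradedModule 𝒜 ℳ)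
    (hmul : IsMultiplicationComp 𝒜 ℳ g) {K N : Submodule R M}
    (h : colonRe 𝒜 ℳ g (compG ℳ K g) ⊆ colonRe 𝒜 ℳ g (compG ℳ N g)) :
    compG ℳ K g ⊆ compG ℳ N g := by
  obtain ⟨J, hJ, hKJ⟩ := hmul (compG ℳ K g) ⟨Set.inter_subset_right,
    ⟨zero_mem K, zero_mem _⟩,
    fun a ha b hb => ⟨K.add_mem ha.1 hb.1, (ℳ g).add_mem ha.2 hb.2⟩,
    fun a ha => ⟨K.neg_mem ha.1, (ℳ g).neg_mem ha.2⟩,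
    fun r hr m hm => ⟨K.smul_mem r hm.1, by simpa using hM.2 hr hm.2⟩⟩
  have hJK : J ⊆ colonRe 𝒜 ℳ g (compG ℳ K g) := fun r hr => ⟨hJ.1 hr, fun m hm => by
    rw [hKJ]
    exact AddSubgroup.subset_closure ⟨r, hr, m, hm, rfl⟩⟩
  rw [hKJ]
  change setSMul J (ℳ g : Set M) ≤ N.toAddSubgroup ⊓ ℳ g
  refine (AddSubgroup.closure_le _).2 ?_
  rintro _ ⟨r, hr, m, hm, rfl⟩
  exact (h (hJK hr)).2 m hm

/-- Suppose `(I_e N_g :_{R_e} M_g) = I_e (N_g :_{R_e} M_g)`, `N_g` is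
a `g`-`I_e`-prime submodule of `M_g`, and `M_g` is a multiplication `R_e`-module.
Then for any graded submodules `K`, `L` of `M` with
`K_g L_g = (K_g :_{R_e} M_g)(L_g :_{R_e} M_g) M_g ⊆ N_g` and `K_g L_g ⊄ I_e N_g`,
either `K_g ⊆ N_g` or `L_g ⊆ N_g`. -/
theorem gIePrimeComp_product_of_submodules
    {G : Type*} [Group G] [DecidableEq G] {R : Type*} [CommRing R]
    {M : Type*} [AddCommGroup M] [Module R M]
    (𝒜 : G → AddSubgroup R) (ℳ : G → AddSubgroup M) (I : Ideal R) (N : Submodule R M)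
    (g : G) (hR : IsGradedRing 𝒜) (hM : IsGradedModule 𝒜 ℳ)
    (hI : IsGradedIdeal 𝒜 I) (hN : IsGradedSubmodule ℳ N) (hNproper : N ≠ ⊤)
    (hcolon : colonRe 𝒜 ℳ g (setSMul (compE 𝒜 I) (compG ℳ N g) : Set M) =
      (setMul (compE 𝒜 I) (colonRe 𝒜 ℳ g (compG ℳ N g)) : Set R))
    (hprime : IsGIePrimeComp 𝒜 ℳ I N g)
    (hmul : IsMultiplicationComp 𝒜 ℳ g) :
    ∀ K L : Submodule R M, IsGradedSubmodule ℳ K → IsGradedSubmodule ℳ L →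
      (setSMul (mulSet (colonRe 𝒜 ℳ g (compG ℳ K g)) (colonRe 𝒜 ℳ g (compG ℳ L g)))
          (ℳ g : Set M) : Set M) ⊆ compG ℳ N g →
      ¬ ((setSMul (mulSet (colonRe 𝒜 ℳ g (compG ℳ K g)) (colonRe 𝒜 ℳ g (compG ℳ L g)))
          (ℳ g : Set M) : Set M) ⊆
            (setSMul (compE 𝒜 I) (compG ℳ N g) : Set M)) →
      compG ℳ K g ⊆ compG ℳ N g ∨ compG ℳ L g ⊆ compG ℳ N g := by
  intro K L _ _ hKL hKLE
  by_contra! hcon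
  refine hKLE ((AddSubgroup.closure_le _).2 ?_)
  rintro _ ⟨_, ⟨a, ha, b, hb, rfl⟩, m, hm, rfl⟩
  refine mul_smul_mem_of_forall_notMem (P := colonRe 𝒜 ℳ g (compG ℳ N g))
    (fun _ h _ h' => add_mem_colonRe_compG h h') (fun _ h _ h' => add_mem_colonRe_compG h h')
    (fun _ h _ h' => add_mem_colonRe_compG h h') (fun _ h => neg_mem_colonRe_compG h)
    (fun h => hcon.1 (compG_subset_of_colonRe_subset hM hmul h))
    (fun h => hcon.2 (compG_subset_of_colonRe_subset hM hmul h)) ?_ a ha b hb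
  intro a ha haN b hb hbN
  exact hprime.mul_smul_mem ha.1 hb.1 (fun x hx => (hb.2 x hx).2) haN hbN
    (fun x hx => hKL (AddSubgroup.subset_closure ⟨_, ⟨a, ha, b, hb, rfl⟩, x, hx, rfl⟩)) hm
end GIePrime
end

section
/- Let G be a group with identity e, R a G-graded commutative ring with identity, M a graded R-module, I a graded ideal of R, N a proper graded submodule of M, and g ∈ G such that (I_e N_g :_{R_e} M_g) = I_e (N_g :_{R_e} M_g). If M_g is a multiplication R_e-module and N_g = N ∩ M_g is a g-I_e-prime submodule of M_g, then for any m₁, m₂ ∈ M_g with m₁m₂ ∈ N_g − I_e N_g, either m₁ ∈ N_g or m₂ ∈ N_g, where m₁m₂ = (R_e m₁ :_{R_e} M_g)(R_e m₂ :_{R_e} M_g)M_g. -/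
/- Common setup: a multiplicative group `G` with identity `1` (the paper's `e`),
a `G`-graded commutative ring `R` with grading `𝒜`, and a graded `R`-module `M`
with grading `ℳ`. -/

namespace GIePrime

variable {G : Type*} [Group G] {R : Type*} [CommRing R]
  {M : Type*} [AddCommGroup M] [Module R M]

section Helpers

variable {𝒜 : G → AddSubgroup R} {ℳ : G → AddSubgroup M} {g : G}

/-- The cyclic `R_e`-submodule generated by an element of `M_g`. -/
theorem isSubmoduleOfMg_smulSet_singleton
    (hmul : ∀ a ∈ 𝒜 1, ∀ b ∈ 𝒜 1, a * b ∈ 𝒜 1) (hsmul : ∀ a ∈ 𝒜 1, ∀ x ∈ ℳ g, a • x ∈ ℳ g)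
    {m : M} (hm : m ∈ ℳ g) :
    IsSubmoduleOfMg 𝒜 ℳ g (smulSet (𝒜 (1 : G) : Set R) {m}) := by
  refine ⟨?_, ⟨0, zero_mem _, m, rfl, (zero_smul R m).symm⟩, ?_, ?_, ?_⟩
  · rintro _ ⟨a, ha, _, rfl, rfl⟩
    exact hsmul a ha _ hm
  · rintro _ ⟨a, ha, _, rfl, rfl⟩ _ ⟨b, hb, _, rfl, rfl⟩
    exact ⟨a + b, add_mem ha hb, _, rfl, (add_smul ..).symm⟩
  · rintro _ ⟨a, ha, _, rfl, rfl⟩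
    exact ⟨-a, neg_mem ha, _, rfl, (neg_smul ..).symm⟩
  · rintro r hr _ ⟨a, ha, _, rfl, rfl⟩
    exact ⟨r * a, hmul r hr a ha, _, rfl, (mul_smul ..).symm⟩

/-- In a multiplication module, every submodule `P` is contained in `(P :_{R_e} M_g) M_g`. -/
theorem IsMultiplicationComp.subset_setSMul_colonRe (h : IsMultiplicationComp 𝒜 ℳ g)
    {P : Set M} (hP : IsSubmoduleOfMg 𝒜 ℳ g P) :
    P ⊆ (setSMul (colonRe 𝒜 ℳ g P) (ℳ g : Set M) : Set M) := by
  obtain ⟨J, hJ, hPJ⟩ := h P hP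
  have hJP : J ⊆ colonRe 𝒜 ℳ g P := fun j hj => ⟨hJ.1 hj, fun x hx => by
    rw [hPJ]
    exact AddSubgroup.subset_closure ⟨j, hj, x, hx, rfl⟩⟩
  intro x hx
  rw [hPJ] at hx
  refine AddSubgroup.closure_mono ?_ hx
  rintro _ ⟨j, hj, y, hy, rfl⟩
  exact ⟨j, hJP hj, y, hy, rfl⟩

theorem smul_mem_setSMul {A : Set R} {B : Set M} {r : R} (hB : ∀ b ∈ B, r • b ∈ B)
    {x : M} (hx : x ∈ setSMul A B) : r • x ∈ setSMul A B := by
  suffices setSMul A B ≤ (setSMul A B).comap (DistribSMul.toAddMonoidHom M r) from this hx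
  refine (AddSubgroup.closure_le _).2 ?_
  rintro _ ⟨a, ha, b, hb, rfl⟩
  exact AddSubgroup.subset_closure ⟨a, ha, r • b, hB b hb, smul_comm r a b⟩

theorem smul_mem_setSMul_mulSet {A B : Set R} {C : Set M} {r : R} (hr : r ∈ A)
    {x : M} (hx : x ∈ setSMul B C) : r • x ∈ setSMul (mulSet A B) C := by
  suffices setSMul B C ≤ (setSMul (mulSet A B) C).comap (DistribSMul.toAddMonoidHom M r) from
    this hx
  refine (AddSubgroup.closure_le _).2 ?_
  rintro _ ⟨b, hb, c, hc, rfl⟩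
  exact AddSubgroup.subset_closure ⟨r * b, ⟨r, hr, b, hb, rfl⟩, c, hc, (mul_smul r b c).symm⟩

/-- If `K m ⊆ N_g` for an additively closed `K ⊆ R_e` with `K M_g ⊄ N_g` and `m ∉ N_g`,
then `K m ⊆ I_e N_g`. -/
theorem IsGIePrimeComp.smul_mem_of_notMem {I : Ideal R} {N : Submodule R M}
    (hprime : IsGIePrimeComp 𝒜 ℳ I N g) {K : Set R} (hK : K ⊆ (𝒜 1 : Set R))
    (hadd : ∀ a ∈ K, ∀ b ∈ K, a + b ∈ K) {m : M} (hm : m ∈ ℳ g)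
    (hKm : ∀ r ∈ K, r • m ∈ compG ℳ N g) (hmN : m ∉ compG ℳ N g)
    (hKN : ¬ K ⊆ colonRe 𝒜 ℳ g (compG ℳ N g)) {r : R} (hr : r ∈ K) :
    r • m ∈ setSMul (compE 𝒜 I) (compG ℳ N g) := by
  have key : ∀ s ∈ K, s ∉ colonRe 𝒜 ℳ g (compG ℳ N g) →
      s • m ∈ setSMul (compE 𝒜 I) (compG ℳ N g) := fun s hs hsN => by
    by_contra hsm
    exact (hprime.2 s (hK hs) m hm (hKm s hs) hsm).elim hmN hsN
  obtain ⟨s, hs, hsN⟩ := Set.not_subset.1 hKN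
  by_cases hrN : r ∈ colonRe 𝒜 ℳ g (compG ℳ N g)
  · have hsum : r + s ∉ colonRe 𝒜 ℳ g (compG ℳ N g) := fun h => by
      refine hsN ⟨hK hs, fun x hx => ?_⟩
      have hsx : s • x = (r + s) • x - r • x := by rw [add_smul, add_sub_cancel_left]
      rw [hsx]
      exact ⟨sub_mem (h.2 x hx).1 (hrN.2 x hx).1, sub_mem (h.2 x hx).2 (hrN.2 x hx).2⟩
    have hrm : r • m = (r + s) • m - s • m := by rw [add_smul, add_sub_cancel_right]
    rw [hrm]
    exact sub_mem (key _ (hadd r hr s hs) hsum) (key s hs hsN)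
  · exact key r hr hrN

end Helpers

/-- Suppose `(I_e N_g :_{R_e} M_g) = I_e (N_g :_{R_e} M_g)`, `M_g` is
a multiplication `R_e`-module and `N_g` is a `g`-`I_e`-prime submodule of `M_g`.  Then
for any `m₁, m₂ ∈ M_g` with `m₁m₂ = (R_e m₁ :_{R_e} M_g)(R_e m₂ :_{R_e} M_g) M_g`
satisfying `m₁m₂ ⊆ N_g` and `m₁m₂ ⊄ I_e N_g`, either `m₁ ∈ N_g` or `m₂ ∈ N_g`. -/
theorem gIePrimeComp_product_of_elements
    {G : Type*} [Group G] [DecidableEq G] {R : Type*} [CommRing R]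
    {M : Type*} [AddCommGroup M] [Module R M]
    (𝒜 : G → AddSubgroup R) (ℳ : G → AddSubgroup M) (I : Ideal R) (N : Submodule R M)
    (g : G) (hR : IsGradedRing 𝒜) (hM : IsGradedModule 𝒜 ℳ)
    (hI : IsGradedIdeal 𝒜 I) (hN : IsGradedSubmodule ℳ N) (hNproper : N ≠ ⊤)
    (hcolon : colonRe 𝒜 ℳ g (setSMul (compE 𝒜 I) (compG ℳ N g) : Set M) =
      (setMul (compE 𝒜 I) (colonRe 𝒜 ℳ g (compG ℳ N g)) : Set R))
    (hmul : IsMultiplicationComp 𝒜 ℳ g)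
    (hprime : IsGIePrimeComp 𝒜 ℳ I N g) :
    ∀ m₁ ∈ ℳ g, ∀ m₂ ∈ ℳ g,
      (setSMul (mulSet (colonRe 𝒜 ℳ g (smulSet (𝒜 (1 : G) : Set R) {m₁}))
          (colonRe 𝒜 ℳ g (smulSet (𝒜 (1 : G) : Set R) {m₂}))) (ℳ g : Set M) : Set M) ⊆
        compG ℳ N g →
      ¬ ((setSMul (mulSet (colonRe 𝒜 ℳ g (smulSet (𝒜 (1 : G) : Set R) {m₁}))
          (colonRe 𝒜 ℳ g (smulSet (𝒜 (1 : G) : Set R) {m₂}))) (ℳ g : Set M) : Set M) ⊆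
            (setSMul (compE 𝒜 I) (compG ℳ N g) : Set M)) →
      m₁ ∈ compG ℳ N g ∨ m₂ ∈ compG ℳ N g := by
  intro m₁ hm₁ m₂ hm₂ hsub hnot
  have hmulRe : ∀ a ∈ 𝒜 1, ∀ b ∈ 𝒜 1, a * b ∈ 𝒜 1 := fun a ha b hb => by
    simpa using hR.2.2 ha hb
  have hsmul : ∀ a ∈ 𝒜 1, ∀ x ∈ ℳ g, a • x ∈ ℳ g := fun a ha x hx => by
    simpa using hM.2 ha hx
  have hself : ∀ m : M, m ∈ smulSet (𝒜 (1 : G) : Set R) {m} := fun m =>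
    ⟨1, hR.2.1, m, rfl, (one_smul R m).symm⟩
  have hcyc₁ := isSubmoduleOfMg_smulSet_singleton hmulRe hsmul hm₁
  have hmem₁ := hmul.subset_setSMul_colonRe hcyc₁ (hself m₁)
  have hmem₂ := hmul.subset_setSMul_colonRe
    (isSubmoduleOfMg_smulSet_singleton hmulRe hsmul hm₂) (hself m₂)
  by_contra! hcon
  obtain ⟨hm₁N, hm₂N⟩ := hcon
  have hK₁ : ¬ colonRe 𝒜 ℳ g (smulSet (𝒜 (1 : G) : Set R) {m₁}) ⊆
      colonRe 𝒜 ℳ g (compG ℳ N g) := fun h => by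
    refine hm₁N ((AddSubgroup.closure_le (N.toAddSubgroup ⊓ ℳ g)).2 ?_ hmem₁)
    rintro _ ⟨r, hr, x, hx, rfl⟩
    exact (h hr).2 x hx
  refine hnot ((AddSubgroup.closure_le _).2 ?_)
  rintro _ ⟨_, ⟨a, ha, b, hb, rfl⟩, x, hx, rfl⟩
  obtain ⟨c, hc, _, rfl, hbx⟩ := hb.2 x hx
  rw [mul_smul, hbx, smul_comm]
  have hcN : ∀ n ∈ compG ℳ N g, c • n ∈ compG ℳ N g := fun n hn =>
    ⟨N.smul_mem c hn.1, hsmul c hc n hn.2⟩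
  refine smul_mem_setSMul hcN
    (hprime.smul_mem_of_notMem (fun r hr => hr.1) ?_ hm₂
      (fun r hr => hsub (smul_mem_setSMul_mulSet hr hmem₂)) hm₂N hK₁ ha)
  exact fun r hr s hs => ⟨add_mem hr.1 hs.1, fun y hy => by
    rw [add_smul]
    exact hcyc₁.2.2.1 _ (hr.2 y hy) _ (hs.2 y hy)⟩

end GIePrime
end

section
/- Let G be a group with identity e, R a G-graded commutative ring with identity, M a graded R-module, I a graded ideal of R, and N a proper graded submodule of M. Then the following are equivalent: (i) N is a graded I_e-prime submodule of M; (ii) for every graded submodule K of M, every r_g ∈ h(R), and every h ∈ G, if r_g K_h ⊆ N and r_g K_h ⊄ I_e N (where K_h = K ∩ M_h), then either K_h ⊆ N or r_g ∈ (N :_R M). -/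
/- Common setup: a multiplicative group `G` with identity `1` (the paper's `e`),
a `G`-graded commutative ring `R` with grading `𝒜`, and a graded `R`-module `M`
with grading `ℳ`. -/

namespace GIePrime

variable {G : Type*} [Group G] {R : Type*} [CommRing R]
  {M : Type*} [AddCommGroup M] [Module R M]

/-- A submodule generated by one homogeneous element is graded. -/
theorem isGradedSubmodule_span_singleton
    {G : Type*} [Group G] [DecidableEq G] {R : Type*} [CommRing R]
    {M : Type*} [AddCommGroup M] [Module R M]
    {𝒜 : G → AddSubgroup R} {ℳ : G → AddSubgroup M}
    (hR : IsGradedRing 𝒜) (hM : IsGradedModule 𝒜 ℳ) {h : G} {m : M} (hm : m ∈ ℳ h) :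
    IsGradedSubmodule ℳ (Submodule.span R {m}) := by
  refine le_antisymm (iSup_le fun g => inf_le_left) fun x hx => ?_
  obtain ⟨a, rfl⟩ := Submodule.mem_span_singleton.1 hx
  obtain ⟨f, rfl⟩ := hR.1.surjective a
  clear hx
  induction f using DirectSum.induction_on with
  | zero => simp
  | of g b =>
    rw [DirectSum.coeAddMonoidHom_of]
    exact AddSubgroup.mem_iSup_of_mem (g * h)
      ⟨Submodule.smul_mem _ _ (Submodule.mem_span_singleton_self m), hM.2 b.2 hm⟩
  | add f₁ f₂ h₁ h₂ =>
    rw [map_add, add_smul]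
    exact add_mem h₁ h₂

/-- A proper graded submodule `N` of `M` is graded `I_e`-prime iff
for every graded submodule `K` of `M`, every homogeneous `r` and every `h ∈ G`:
`r K_h ⊆ N` and `r K_h ⊄ I_e N` imply `K_h ⊆ N` or `r ∈ (N :_R M)`. -/
theorem gradedIePrime_iff_component_condition
    {G : Type*} [Group G] [DecidableEq G] {R : Type*} [CommRing R]
    {M : Type*} [AddCommGroup M] [Module R M]
    (𝒜 : G → AddSubgroup R) (ℳ : G → AddSubgroup M) (I : Ideal R) (N : Submodule R M)
    (hR : IsGradedRing 𝒜) (hM : IsGradedModule 𝒜 ℳ)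
    (hI : IsGradedIdeal 𝒜 I) (hN : IsGradedSubmodule ℳ N) (hNproper : N ≠ ⊤) :
    IsGradedIePrime 𝒜 ℳ I N ↔
      ∀ K : Submodule R M, IsGradedSubmodule ℳ K → ∀ r ∈ homog 𝒜, ∀ h : G,
        smulSet {r} (compG ℳ K h) ⊆ (N : Set M) →
        ¬ (smulSet {r} (compG ℳ K h) ⊆ (ieSmul 𝒜 I N : Set M)) →
        compG ℳ K h ⊆ (N : Set M) ∨ ∀ x : M, r • x ∈ N := by
  constructor
  · rintro ⟨-, hp⟩ K - r hr h hrN hrE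
    obtain ⟨k₀, hk₀, hk₀E⟩ : ∃ k₀ ∈ compG ℳ K h, r • k₀ ∉ ieSmul 𝒜 I N := by
      obtain ⟨_, ⟨_, rfl, k₀, hk₀, rfl⟩, hk₀E⟩ := Set.not_subset.1 hrE
      exact ⟨k₀, hk₀, hk₀E⟩
    have homog_of_mem : ∀ k ∈ ℳ h, k ∈ homog ℳ := fun k hk => Set.mem_iUnion.2 ⟨h, hk⟩
    have smul_mem : ∀ k ∈ compG ℳ K h, r • k ∈ N := fun k hk => hrN ⟨_, rfl, k, hk, rfl⟩
    refine or_iff_not_imp_right.2 fun hcolon k hk => ?_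
    have mem_of_notMem : ∀ k ∈ compG ℳ K h, r • k ∉ ieSmul 𝒜 I N → k ∈ N := fun k hk hkE =>
      (hp r hr k (homog_of_mem k hk.2) (smul_mem k hk) hkE).resolve_left hcolon
    by_cases hkE : r • k ∈ ieSmul 𝒜 I N
    · have hsum : k + k₀ ∈ N := by
        refine mem_of_notMem _ ⟨add_mem hk.1 hk₀.1, add_mem hk.2 hk₀.2⟩ ?_
        rw [smul_add, Submodule.add_mem_iff_right _ hkE]
        exact hk₀E
      exact (Submodule.add_mem_iff_left _ (mem_of_notMem _ hk₀ hk₀E)).1 hsum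
    · exact mem_of_notMem _ hk hkE
  · refine fun H => ⟨hNproper, fun r hr m hm hrN hrE => ?_⟩
    obtain ⟨h, hmh⟩ := Set.mem_iUnion.1 hm
    have hmK : m ∈ compG ℳ (Submodule.span R {m}) h :=
      ⟨Submodule.mem_span_singleton_self m, hmh⟩
    refine ((H _ (isGradedSubmodule_span_singleton hR hM hmh) r hr h ?_ fun hsub =>
      hrE (hsub ⟨r, rfl, m, hmK, rfl⟩)).imp_left fun hK => hK hmK).symm
    rintro _ ⟨_, rfl, k, hk, rfl⟩
    obtain ⟨a, rfl⟩ := Submodule.mem_span_singleton.1 hk.1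
    rw [smul_comm]
    exact N.smul_mem a hrN
end GIePrime
end
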